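/- For each Euclidean unit vector ν let μ⁻¹(ν) ∈ S denote the unique point m with ⟨ν,z⟩ ≤ ⟨ν,m⟩ for all z with N(z) ≤ 1 (the inverse Gauss map). For ν with |ν| = 1 and v ∈ S with ⟨ν,v⟩ > 0 set λ(ν,v) = ⟨ν, μ⁻¹(ν)⟩/⟨ν,v⟩ (the unique scalar with λ(ν,v)·v − μ⁻¹(ν) Euclidean-orthogonal to ν), and define Λ(ν,v) = (λ(ν,v) − 1)/N(μ⁻¹(ν) − v) when μ⁻¹(ν) ≠ v and Λ(ν,v) = 0 otherwise. If v₀ ∈ S has regular direction and ν₀ is its unique supporting Euclidean unit normal (so μ⁻¹(ν₀) = v₀), then Λ is continuous at (ν₀, v₀): for every ε > 0 there is δ > 0 such that for all ν with |ν| = 1 and v ∈ S with ⟨ν,v⟩ > 0, |ν − ν₀| < δ and |v − v₀| < δ imply |Λ(ν,v)| < ε. -/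

import Mathlib

open scoped RealInnerProductSpace

/- `Λ(ν,v) = (λ(ν,v) - 1) / N (μ⁻¹(ν) - v)` where `λ(ν,v) = ⟪ν, μ⁻¹(ν)⟫/⟪ν,v⟫` is the
unique scalar with `λ(ν,v) • v - μ⁻¹(ν)` Euclidean-orthogonal to `ν`; and
`Λ(ν,v) = 0` when `μ⁻¹(ν) = v`. -/
open Classical in
noncomputable def Lam {n : ℕ} (N : EuclideanSpace ℝ (Fin n) → ℝ)
    (μinv : EuclideanSpace ℝ (Fin n) → EuclideanSpace ℝ (Fin n))
    (ν v : EuclideanSpace ℝ (Fin n)) : ℝ :=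
  if μinv ν = v then 0
  else (⟪ν, μinv ν⟫ / ⟪ν, v⟫ - 1) / N (μinv ν - v)

/-- A function satisfying the norm axioms on `ℝⁿ` dominates a multiple of the Euclidean norm. -/
lemma exists_norm_le_mul_of_norm_axioms {n : ℕ} (N : EuclideanSpace ℝ (Fin n) → ℝ)
    (hN0 : ∀ z, N z = 0 ↔ z = 0)
    (hNh : ∀ (c : ℝ) (z : EuclideanSpace ℝ (Fin n)), N (c • z) = |c| * N z)
    (hNt : ∀ z w : EuclideanSpace ℝ (Fin n), N (z + w) ≤ N z + N w) :
    ∃ C > 0, ∀ x, ‖x‖ ≤ C * N x := by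
  have hconv : ConvexOn ℝ Set.univ N := by
    refine ⟨convex_univ, fun x _ y _ a b ha hb _ => ?_⟩
    calc N (a • x + b • y) ≤ N (a • x) + N (b • y) := hNt _ _
      _ = a • N x + b • N y := by
        rw [hNh, hNh, abs_of_nonneg ha, abs_of_nonneg hb, smul_eq_mul, smul_eq_mul]
  have hcont : Continuous N := by
    have := hconv.continuousOn_interior
    rwa [interior_univ, continuousOn_univ] at this
  have hnonneg : ∀ x, 0 ≤ N x := fun x => by
    have h1 := hNt x ((-1 : ℝ) • x)
    have h2 := hNh (-1) x
    have h3 : N (x + (-1 : ℝ) • x) = 0 := (hN0 _).2 (by simp)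
    rw [h3, h2] at h1
    norm_num at h1
    linarith
  rcases (Metric.sphere (0 : EuclideanSpace ℝ (Fin n)) 1).eq_empty_or_nonempty with hS | hS
  · refine ⟨1, one_pos, fun x => ?_⟩
    by_cases hx : x = 0
    · simpa [hx] using hnonneg 0
    · have : ‖x‖⁻¹ • x ∈ Metric.sphere (0 : EuclideanSpace ℝ (Fin n)) 1 := by
        simp [norm_smul, hx]
      simp [hS] at this
  · obtain ⟨u, hu, hmin⟩ := (isCompact_sphere _ _).exists_isMinOn hS hcont.continuousOn
    have hu1 : ‖u‖ = 1 := by simpa using hu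
    have hu0 : u ≠ 0 := by
      rintro rfl
      simp at hu1
    have hpos : 0 < N u := lt_of_le_of_ne (hnonneg u) fun h => hu0 ((hN0 u).1 h.symm)
    refine ⟨(N u)⁻¹, inv_pos.2 hpos, fun x => ?_⟩
    by_cases hx : x = 0
    · simpa [hx] using mul_nonneg (inv_nonneg.2 hpos.le) (hnonneg 0)
    · have hx' : 0 < ‖x‖ := norm_pos_iff.2 hx
      have hmem : ‖x‖⁻¹ • x ∈ Metric.sphere (0 : EuclideanSpace ℝ (Fin n)) 1 := by
        simp [norm_smul, hx]
      have h : N u ≤ N (‖x‖⁻¹ • x) := hmin hmem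
      rw [hNh, abs_of_pos (inv_pos.2 hx'), inv_mul_eq_div, le_div_iff₀ hx'] at h
      rwa [inv_mul_eq_div, le_div_iff₀ hpos, mul_comm]

/-- Every point of the unit sphere of a norm on `ℝⁿ` has a supporting Euclidean unit normal. -/
lemma exists_unit_normal_of_norm_axioms {n : ℕ} (N : EuclideanSpace ℝ (Fin n) → ℝ)
    (hNh : ∀ (c : ℝ) (z : EuclideanSpace ℝ (Fin n)), N (c • z) = |c| * N z)
    (hNt : ∀ z w : EuclideanSpace ℝ (Fin n), N (z + w) ≤ N z + N w)
    (v : EuclideanSpace ℝ (Fin n)) (hv : N v = 1) :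
    ∃ η : EuclideanSpace ℝ (Fin n), ‖η‖ = 1 ∧ ∀ z, N z ≤ 1 → ⟪η, z⟫ ≤ ⟪η, v⟫ := by
  have hv0 : v ≠ 0 := by
    rintro rfl
    have := hNh 0 0
    simp [hv] at this
  obtain ⟨g, hgf, hgN⟩ := exists_extension_of_le_sublinear
    (LinearPMap.mkSpanSingleton (K := ℝ) v (1 : ℝ) hv0) N
    (fun c hc x => by rw [hNh, abs_of_pos hc]) hNt (by
      rintro ⟨x, hx⟩
      obtain ⟨c, rfl⟩ := Submodule.mem_span_singleton.1 hx
      rw [LinearPMap.mkSpanSingleton'_apply, hNh, hv]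
      simpa using le_abs_self c)
  have hgv : g v = 1 := (hgf ⟨v, Submodule.mem_span_singleton_self v⟩).trans
    (LinearPMap.mkSpanSingleton_apply ℝ ℝ hv0 1)
  set w := (InnerProductSpace.toDual ℝ (EuclideanSpace ℝ (Fin n))).symm
    (LinearMap.toContinuousLinearMap g) with hw
  have hinner : ∀ z, ⟪w, z⟫ = g z := fun z => by simp [hw]
  have hw0 : 0 < ‖w‖ := norm_pos_iff.2 fun h => by
    have := hinner v
    simp [h, hgv] at this
  refine ⟨‖w‖⁻¹ • w, by simp [norm_smul, hw0.ne'], fun z hz => ?_⟩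
  rw [real_inner_smul_left, real_inner_smul_left, hinner, hinner, hgv]
  exact mul_le_mul_of_nonneg_left ((hgN z).trans hz) (inv_nonneg.2 hw0.le)

/-- Supporting unit normals at points converging to a point with a unique supporting unit normal
converge to that normal. -/
lemma exists_forall_norm_sub_unit_normal_lt {n : ℕ} (B : Set (EuclideanSpace ℝ (Fin n)))
    (ν₀ v₀ : EuclideanSpace ℝ (Fin n))
    (huniq : ∀ η : EuclideanSpace ℝ (Fin n), ‖η‖ = 1 → (∀ z ∈ B, ⟪η, z⟫ ≤ ⟪η, v₀⟫) → η = ν₀)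
    {ε : ℝ} (hε : 0 < ε) :
    ∃ δ > 0, ∀ v η : EuclideanSpace ℝ (Fin n), ‖η‖ = 1 → (∀ z ∈ B, ⟪η, z⟫ ≤ ⟪η, v⟫) →
      ‖v - v₀‖ < δ → ‖η - ν₀‖ < ε := by
  by_contra! hcon
  choose v η hη hsupp hv hfar using fun k : ℕ => hcon (1 / ((k : ℝ) + 1)) Nat.one_div_pos_of_nat
  obtain ⟨a, ha, φ, hφ, hlim⟩ := (isCompact_sphere (0 : EuclideanSpace ℝ (Fin n)) 1).tendsto_subseq
    (x := η) (fun k => by simpa using hη k)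
  have hvlim : Filter.Tendsto v Filter.atTop (nhds v₀) :=
    tendsto_iff_norm_sub_tendsto_zero.2 <| squeeze_zero (fun _ => norm_nonneg _)
      (fun k => (hv k).le) tendsto_one_div_add_atTop_nhds_zero_nat
  have haν : a = ν₀ := huniq a (by simpa using ha) fun z hz =>
    le_of_tendsto_of_tendsto' (hlim.inner tendsto_const_nhds)
      (hlim.inner (hvlim.comp hφ.tendsto_atTop)) fun k => hsupp (φ k) z hz
  subst haν
  have h0 : ε ≤ ‖a - a‖ := ge_of_tendsto' (hlim.sub_const a).norm fun k => hfar (φ k)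
  simp at h0
  linarith

/-- If `v₀` has regular direction with unique supporting Euclidean unit normal `ν₀`
(so `μ⁻¹(ν₀) = v₀`), then `Λ` is continuous at `(ν₀, v₀)`. -/
theorem lambda_continuous_at_regular_direction {n : ℕ}
    (N : EuclideanSpace ℝ (Fin n) → ℝ)
    (hN0 : ∀ z, N z = 0 ↔ z = 0)
    (hNh : ∀ (c : ℝ) (z : EuclideanSpace ℝ (Fin n)), N (c • z) = |c| * N z)
    (hNt : ∀ z w : EuclideanSpace ℝ (Fin n), N (z + w) ≤ N z + N w)
    (hsc : ∀ x y : EuclideanSpace ℝ (Fin n), N x = 1 → N y = 1 → x ≠ y →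
      N ((2 : ℝ)⁻¹ • (x + y)) < 1)
    (μinv : EuclideanSpace ℝ (Fin n) → EuclideanSpace ℝ (Fin n))
    (hμ : ∀ ν, ‖ν‖ = 1 → N (μinv ν) = 1 ∧ ∀ z, N z ≤ 1 → ⟪ν, z⟫ ≤ ⟪ν, μinv ν⟫)
    (ν₀ v₀ : EuclideanSpace ℝ (Fin n)) (hν₀ : ‖ν₀‖ = 1) (hv₀ : N v₀ = 1)
    (hreg : ∃! ν : EuclideanSpace ℝ (Fin n),
      ‖ν‖ = 1 ∧ ∀ z, N z ≤ 1 → ⟪ν, z⟫ ≤ ⟪ν, v₀⟫)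
    (hν₀supp : ∀ z, N z ≤ 1 → ⟪ν₀, z⟫ ≤ ⟪ν₀, v₀⟫)
    (hμν₀ : μinv ν₀ = v₀) :
    ∀ ε > 0, ∃ δ > 0, ∀ ν v : EuclideanSpace ℝ (Fin n),
      ‖ν‖ = 1 → N v = 1 → 0 < ⟪ν, v⟫ →
      ‖ν - ν₀‖ < δ → ‖v - v₀‖ < δ → |Lam N μinv ν v| < ε := by
  intro ε hε
  obtain ⟨C, hC, hCN⟩ := exists_norm_le_mul_of_norm_axioms N hN0 hNh hNt
  have hNpos : ∀ x, x ≠ 0 → 0 < N x := fun x hx =>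
    pos_of_mul_pos_right ((norm_pos_iff.2 hx).trans_le (hCN x)) hC.le
  have hc : 0 < ⟪ν₀, v₀⟫ := by
    have hν0 : ν₀ ≠ 0 := norm_ne_zero_iff.1 (by simp [hν₀])
    have hp := inv_pos.2 (hNpos ν₀ hν0)
    have h := hν₀supp ((N ν₀)⁻¹ • ν₀) (by
      rw [hNh, abs_of_pos hp, inv_mul_cancel₀ (hNpos ν₀ hν0).ne'])
    rw [real_inner_smul_right, real_inner_self_eq_norm_sq, hν₀] at h
    linarith
  set c := ⟪ν₀, v₀⟫ with hcdef
  set r := ε * c / (4 * C) with hrdef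
  have hr : 0 < r := by positivity
  obtain ⟨δ₁, hδ₁, hnormal⟩ := exists_forall_norm_sub_unit_normal_lt {z | N z ≤ 1} ν₀ v₀
    (fun η hη hs => hreg.unique ⟨hη, hs⟩ ⟨hν₀, hν₀supp⟩) hr
  obtain ⟨δ₂, hδ₂, hinner⟩ := Metric.continuousAt_iff.1
    ((continuous_inner (𝕜 := ℝ) (E := EuclideanSpace ℝ (Fin n))).continuousAt (x := (ν₀, v₀)))
    (c / 2) (half_pos hc)
  refine ⟨min r (min δ₁ δ₂), by positivity, fun ν v hν hv hνv hνδ hvδ => ?_⟩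
  rw [lt_min_iff, lt_min_iff] at hνδ hvδ
  have hhalf : c / 2 < ⟪ν, v⟫ := by
    have h := hinner (show dist (ν, v) (ν₀, v₀) < δ₂ by
      rw [Prod.dist_eq, max_lt_iff, dist_eq_norm, dist_eq_norm]
      exact ⟨hνδ.2.2, hvδ.2.2⟩)
    rw [Real.dist_eq, abs_lt] at h
    linarith [h.1]
  obtain ⟨η, hη, hηs⟩ := exists_unit_normal_of_norm_axioms N hNh hNt v hv
  have hην := hnormal v η hη hηs hvδ.2.1
  obtain ⟨hm, hms⟩ := hμ ν hν
  unfold Lam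
  split_ifs with hmv
  · simpa using hε
  · have hD := hNpos _ (sub_ne_zero.2 hmv)
    have hnn : 0 ≤ ⟪ν, μinv ν⟫ - ⟪ν, v⟫ := sub_nonneg.2 (hms v hv.le)
    have heq : (⟪ν, μinv ν⟫ / ⟪ν, v⟫ - 1) / N (μinv ν - v)
        = (⟪ν, μinv ν⟫ - ⟪ν, v⟫) / (⟪ν, v⟫ * N (μinv ν - v)) := by
      field_simp
    rw [heq, abs_of_nonneg (by positivity), div_lt_iff₀ (by positivity)]
    have hclose : ‖ν - η‖ ≤ 2 * r := by
      have := norm_sub_le_norm_sub_add_norm_sub ν ν₀ η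
      rw [norm_sub_rev ν₀ η] at this
      linarith [hνδ.1]
    calc ⟪ν, μinv ν⟫ - ⟪ν, v⟫ = ⟪ν - η, μinv ν - v⟫ + (⟪η, μinv ν⟫ - ⟪η, v⟫) := by
          simp only [inner_sub_left, inner_sub_right]
          ring
      _ ≤ ⟪ν - η, μinv ν - v⟫ := by linarith [hηs _ hm.le]
      _ ≤ ‖ν - η‖ * ‖μinv ν - v‖ := real_inner_le_norm _ _
      _ ≤ 2 * r * (C * N (μinv ν - v)) := by
          gcongr
          exact hCN _
      _ = ε * (c / 2 * N (μinv ν - v)) := by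
          rw [hrdef]
          field_simp
          ring
      _ < ε * (⟪ν, v⟫ * N (μinv ν - v)) := by gcongr
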